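/- Let q be a prime power and λ ∈ F_q \ {0}. The incidence structure I_λ = (F_q³, L_λ) is triangle-free: there do not exist three distinct lines in L_λ that pairwise intersect in three distinct points. -/

import Mathlib

/-- The `λ`-moment curve `M_λ = {(1, λα, λα²) : α ∈ F \ {0}} ⊆ F³`. -/
def momentCurve {F : Type*} [Field F] (lam : F) : Set (F × F × F) :=
  {p | ∃ a : F, a ≠ 0 ∧ p = (1, lam * a, lam * a ^ 2)}

/-- The affine line `ℓ_{s,v} = {β • s + v : β ∈ F} ⊆ F³`. -/
def affLine {F : Type*} [Field F] (s v : F × F × F) : Set (F × F × F) :=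
  {p | ∃ b : F, p = b • s + v}

/-- `L_λ`: the set of affine lines of `F³` whose slope lies on the
`λ`-moment curve. -/
def lineSet {F : Type*} [Field F] (lam : F) : Set (Set (F × F × F)) :=
  {l | ∃ s ∈ momentCurve lam, ∃ v : F × F × F, l = affLine s v}

theorem affLine_eq_of_mem {F : Type*} [Field F] {s v x : F × F × F}
    (hx : x ∈ affLine s v) : affLine s v = affLine s x := by
  obtain ⟨b, rfl⟩ := hx
  ext p
  constructor
  · rintro ⟨c, rfl⟩
    exact ⟨c - b, by module⟩
  · rintro ⟨c, rfl⟩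
    exact ⟨c + b, by module⟩

theorem exists_sub_eq_smul_of_mem_affLine {F : Type*} [Field F] {s v x y : F × F × F}
    (hx : x ∈ affLine s v) (hy : y ∈ affLine s v) : ∃ t : F, y - x = t • s := by
  obtain ⟨b, rfl⟩ := hx
  obtain ⟨c, rfl⟩ := hy
  exact ⟨c - b, by module⟩

/-- Any three vectors `(1, λa, λa²)` with distinct parameters are linearly independent;
here one coefficient of a vanishing combination. -/
theorem eq_zero_of_smul_add_eq_zero {F : Type*} [Field F] {lam a b c r s t : F}
    (hlam : lam ≠ 0) (hab : a ≠ b) (hac : a ≠ c)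
    (h : r • ((1, lam * a, lam * a ^ 2) : F × F × F) + s • (1, lam * b, lam * b ^ 2)
      + t • (1, lam * c, lam * c ^ 2) = 0) : r = 0 := by
  simp only [Prod.smul_mk, Prod.mk_add_mk, Prod.mk_eq_zero, smul_eq_mul] at h
  obtain ⟨h₀, h₁, h₂⟩ := h
  have key : r * (lam * ((a - b) * (a - c))) = 0 := by
    linear_combination h₂ - (b + c) * h₁ + lam * b * c * h₀
  exact (mul_eq_zero.mp key).resolve_right
    (mul_ne_zero hlam (mul_ne_zero (sub_ne_zero.mpr hab) (sub_ne_zero.mpr hac)))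

/-- The incidence structure `I_λ = (F³, L_λ)` is triangle-free: there do not
exist three distinct lines in `L_λ` pairwise intersecting in three distinct
points. -/
theorem stmt_5 (F : Type*) [Field F] [Fintype F] (lam : F) (hlam : lam ≠ 0) :
    ¬ ∃ l₁ ∈ lineSet lam, ∃ l₂ ∈ lineSet lam, ∃ l₃ ∈ lineSet lam,
      l₁ ≠ l₂ ∧ l₂ ≠ l₃ ∧ l₁ ≠ l₃ ∧
      ∃ x y z : F × F × F, x ≠ y ∧ y ≠ z ∧ x ≠ z ∧
        x ∈ l₁ ∩ l₂ ∧ y ∈ l₂ ∩ l₃ ∧ z ∈ l₃ ∩ l₁ := by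
  rintro ⟨_, ⟨_, ⟨a₁, -, rfl⟩, v₁, rfl⟩, _, ⟨_, ⟨a₂, -, rfl⟩, v₂, rfl⟩,
    _, ⟨_, ⟨a₃, -, rfl⟩, v₃, rfl⟩, h₁₂, h₂₃, -, x, y, z, hxy, -, -,
    ⟨hx₁, hx₂⟩, ⟨hy₂, hy₃⟩, ⟨hz₃, hz₁⟩⟩
  have h₂₁' : a₂ ≠ a₁ := by
    rintro rfl
    exact h₁₂ ((affLine_eq_of_mem hx₁).trans (affLine_eq_of_mem hx₂).symm)
  have h₂₃' : a₂ ≠ a₃ := by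
    rintro rfl
    exact h₂₃ ((affLine_eq_of_mem hy₂).trans (affLine_eq_of_mem hy₃).symm)
  obtain ⟨t₂, ht₂⟩ := exists_sub_eq_smul_of_mem_affLine hx₂ hy₂
  obtain ⟨t₃, ht₃⟩ := exists_sub_eq_smul_of_mem_affLine hy₃ hz₃
  obtain ⟨t₁, ht₁⟩ := exists_sub_eq_smul_of_mem_affLine hz₁ hx₁
  have ht : t₂ = 0 := by
    refine eq_zero_of_smul_add_eq_zero (s := t₁) (t := t₃) hlam h₂₁' h₂₃' ?_
    rw [← ht₁, ← ht₂, ← ht₃]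
    abel
  rw [ht, zero_smul, sub_eq_zero] at ht₂
  exact hxy ht₂.symm
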